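/- Let P be a probability distribution that is Markov with respect to a finite DAG G on vertex set V (satisfying the local Markov property: each vertex is independent of its non-descendants given its parents). For disjoint sets A, B, C ⊆ V, if Pa(A) ⊆ C ∪ A, Pa(B) ⊆ C ∪ B, and Des(B) ∩ C = ∅, then A is independent of B given C under P. -/

import Mathlib

open Relation

/-- Undirected adjacency induced by a directed edge relation. -/
def Adjacent {V : Type*} (E : V → V → Prop) (a b : V) : Prop := E a b ∨ E b a

/-- `x` is a collider on the path (vertex list) `p`: both neighboring edges point into `x`. -/
def IsCollider {V : Type*} (E : V → V → Prop) (p : List V) (x : V) : Prop :=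
  ∃ l1 a b l2, p = l1 ++ a :: x :: b :: l2 ∧ E a x ∧ E b x

/-- A path (vertex list) is active given a conditioning set `C`:
every collider is in `C` or has a descendant in `C`, and no non-collider is in `C`. -/
def ActivePath {V : Type*} (E : V → V → Prop) (C : Set V) (p : List V) : Prop :=
  (∀ x ∈ p, IsCollider E p x → ∃ d, ReflTransGen E x d ∧ d ∈ C) ∧
  (∀ x ∈ p, ¬ IsCollider E p x → x ∉ C)

/-- `p` is a path between `u` and `v`: consecutively adjacent, distinct vertices. -/
def IsPathBetween {V : Type*} (E : V → V → Prop) (u v : V) (p : List V) : Prop :=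
  p.Chain' (Adjacent E) ∧ p.Nodup ∧ p.head? = some u ∧ p.getLast? = some v

/-- `u` and `v` are d-connected given `C`. -/
def DConn {V : Type*} (E : V → V → Prop) (C : Set V) (u v : V) : Prop :=
  ∃ p, IsPathBetween E u v p ∧ ActivePath E C p

/-- `u` and `v` are d-separated given `C`. -/
def DSep {V : Type*} (E : V → V → Prop) (C : Set V) (u v : V) : Prop :=
  ¬ DConn E C u v

/-- `S` is a prefix (ancestrally closed) subset. -/
def IsPrefixSet {V : Type*} (E : V → V → Prop) (S : Set V) : Prop :=
  ∀ u v, E u v → v ∈ S → u ∈ S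

/-- Source vertices of the induced subgraph on `T`: vertices of `T` with no parent in `T`. -/
def srcOf {V : Type*} (E : V → V → Prop) (T : Set V) : Set V :=
  {v | v ∈ T ∧ ∀ u, E u v → u ∉ T}

/-- The edge relation is acyclic. -/
def Acyclic {V : Type*} (E : V → V → Prop) : Prop :=
  ∀ v, ¬ TransGen E v v

/-- `p` is a directed path from `u` to `v` (all edges forward). -/
def DirPath {V : Type*} (E : V → V → Prop) (u v : V) (p : List V) : Prop :=
  p.Chain' E ∧ p.head? = some u ∧ p.getLast? = some v

open MeasureTheory ProbabilityTheory

/-- The σ-algebra on `Ω` generated by the variables `X t` for `t` in the set `T`. -/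
def genBy {V Ω : Type*} [MeasurableSpace Ω] (X : V → Ω → ℝ) (T : Set V) :
    MeasurableSpace Ω :=
  MeasurableSpace.comap (fun ω => fun t : T => X t ω) inferInstance

section GenBy

variable {V Ω : Type*} [MeasurableSpace Ω]

lemma genBy_eq_iSup (X : V → Ω → ℝ) (T : Set V) :
    genBy X T = ⨆ t ∈ T, MeasurableSpace.comap (X t) inferInstance := by
  rw [iSup_subtype']
  change MeasurableSpace.comap _ MeasurableSpace.pi = _
  simp only [MeasurableSpace.pi, MeasurableSpace.comap_iSup, MeasurableSpace.comap_comp]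
  rfl

lemma genBy_mono (X : V → Ω → ℝ) {S T : Set V} (h : S ⊆ T) : genBy X S ≤ genBy X T := by
  rw [genBy_eq_iSup, genBy_eq_iSup]
  exact biSup_mono h

lemma genBy_insert (X : V → Ω → ℝ) (v : V) (T : Set V) :
    genBy X (insert v T) = MeasurableSpace.comap (X v) inferInstance ⊔ genBy X T := by
  rw [genBy_eq_iSup, genBy_eq_iSup, iSup_insert]

lemma genBy_le {X : V → Ω → ℝ} (hX : ∀ v, Measurable (X v)) (T : Set V) :
    genBy X T ≤ ‹MeasurableSpace Ω› :=
  (measurable_pi_lambda _ fun t : T => hX t).comap_le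

end GenBy

section CondIndep

variable {Ω : Type*} {m' m'' m₁ m₂ m₃ mΩ : MeasurableSpace Ω}
  {μ : Measure Ω} [IsFiniteMeasure μ]

lemma condExp_indicator_inter_of_measurableSet {s d : Set Ω}
    (hs : MeasurableSet s) (hd : MeasurableSet[m'] d) :
    μ⟦s ∩ d | m'⟧ =ᵐ[μ] d.indicator (μ⟦s | m'⟧) := by
  rw [Set.inter_comm, ← Set.indicator_indicator]
  exact condExp_indicator ((integrable_const 1).indicator hs) hd

lemma condExp_indicator_condExp (s : Set Ω) {t : Set Ω} (ht : MeasurableSet t) :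
    μ[t.indicator (μ⟦s | m'⟧) | m'] =ᵐ[μ] μ⟦s | m'⟧ * μ⟦t | m'⟧ := by
  have heq : t.indicator (μ⟦s | m'⟧) = μ⟦s | m'⟧ * t.indicator (fun _ => (1 : ℝ)) := by
    ext ω
    by_cases hω : ω ∈ t <;> simp [hω]
  have hint : Integrable (t.indicator (μ⟦s | m'⟧)) μ := integrable_condExp.indicator ht
  rw [heq] at hint ⊢
  exact condExp_mul_of_stronglyMeasurable_left stronglyMeasurable_condExp hint
    ((integrable_const 1).indicator ht)

variable [StandardBorelSpace Ω]

/-- The conditioning σ-algebra can be added to one side of a conditional independence. -/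
lemma CondIndep.sup_right (hm : m' ≤ mΩ) (h₁ : m₁ ≤ mΩ) (h₂ : m₂ ≤ mΩ)
    (h : CondIndep m' m₁ m₂ hm μ) : CondIndep m' m₁ (m₂ ⊔ m') hm μ := by
  have hsup : m₂ ⊔ m' =
      MeasurableSpace.generateFrom {r | ∃ t, MeasurableSet[m₂] t ∧ ∃ d, MeasurableSet[m'] d ∧
        t ∩ d = r} := by
    refine le_antisymm (sup_le (fun t ht => ?_) (fun d hd => ?_))
      (MeasurableSpace.generateFrom_le ?_)
    · exact MeasurableSpace.measurableSet_generateFrom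
        ⟨t, ht, Set.univ, MeasurableSet.univ, Set.inter_univ t⟩
    · exact MeasurableSpace.measurableSet_generateFrom
        ⟨Set.univ, MeasurableSet.univ, d, hd, Set.univ_inter d⟩
    · rintro _ ⟨t, ht, d, hd, rfl⟩
      have ht' : MeasurableSet[m₂ ⊔ m'] t := (le_sup_left : m₂ ≤ m₂ ⊔ m') t ht
      exact ht'.inter ((le_sup_right : m' ≤ m₂ ⊔ m') d hd)
  refine CondIndepSets.condIndep h₁ (sup_le h₂ hm)
    (@MeasurableSpace.isPiSystem_measurableSet _ m₁) ?_
    (@MeasurableSpace.generateFrom_measurableSet _ m₁).symm hsup ?_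
  · rintro _ ⟨t, ht, d, hd, rfl⟩ _ ⟨t', ht', d', hd', rfl⟩ -
    exact ⟨t ∩ t', ht.inter ht', d ∩ d', hd.inter hd', Set.inter_inter_inter_comm ..⟩
  · refine (condIndepSets_iff _ _ _ _ (fun s hs => h₁ s hs) ?_ μ).2 ?_
    · rintro _ ⟨t, ht, d, hd, rfl⟩
      exact (h₂ t ht).inter (hm d hd)
    rintro s _ hs ⟨t, ht, d, hd, rfl⟩
    have hst := (condIndep_iff _ _ _ hm h₁ h₂ μ).1 h s t hs ht
    rw [← Set.inter_assoc]
    filter_upwards [hst,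
      condExp_indicator_inter_of_measurableSet (μ := μ) ((h₁ s hs).inter (h₂ t ht)) hd,
      condExp_indicator_inter_of_measurableSet (μ := μ) (h₂ t ht) hd] with ω h1 h2 h3
    simp only [Pi.mul_apply] at h1 ⊢
    by_cases hω : ω ∈ d <;> simp_all

/-- When the conditioning σ-algebra is contained in `m₂`, independence of `m₁` and `m₂` given `m'`
means that conditioning events of `m₁` on `m₂` or on `m'` gives the same result. -/
lemma condIndep_iff_condExp_ae_eq (hm : m' ≤ mΩ) (h₁ : m₁ ≤ mΩ) (h₂ : m₂ ≤ mΩ) (hle : m' ≤ m₂) :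
    CondIndep m' m₁ m₂ hm μ ↔ ∀ s, MeasurableSet[m₁] s → μ⟦s | m₂⟧ =ᵐ[μ] μ⟦s | m'⟧ := by
  rw [condIndep_iff _ _ _ hm h₁ h₂]
  refine ⟨fun h s hs => ?_, fun h s t hs ht => ?_⟩
  · have hs_int : Integrable (s.indicator fun _ => (1 : ℝ)) μ :=
      (integrable_const 1).indicator (h₁ s hs)
    refine (ae_eq_condExp_of_forall_setIntegral_eq h₂ hs_int
      (fun _ _ _ => integrable_condExp.integrableOn) (fun t ht _ => ?_)
      (stronglyMeasurable_condExp.mono hle).aestronglyMeasurable).symm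
    have ht' := h₂ t ht
    rw [← integral_indicator ht', ← integral_indicator ht', ← integral_condExp hm,
      integral_congr_ae (condExp_indicator_condExp s ht'),
      integral_congr_ae (h s t hs ht).symm, integral_condExp hm, Set.indicator_indicator,
      Set.inter_comm]
  · have hs_int : Integrable (s.indicator fun _ => (1 : ℝ)) μ :=
      (integrable_const 1).indicator (h₁ s hs)
    calc μ⟦s ∩ t | m'⟧
      _ =ᵐ[μ] μ[μ⟦s ∩ t | m₂⟧ | m'] := (condExp_condExp_of_le hle h₂).symm
      _ =ᵐ[μ] μ[t.indicator (μ⟦s | m'⟧) | m'] := by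
        refine condExp_congr_ae ?_
        filter_upwards [condExp_indicator_inter_of_measurableSet (μ := μ) (h₁ s hs) ht, h s hs]
          with ω h1 h2
        rw [h1]
        by_cases hω : ω ∈ t <;> simp [hω, h2]
      _ =ᵐ[μ] μ⟦s | m'⟧ * μ⟦t | m'⟧ := condExp_indicator_condExp s (h₂ t ht)

/-- Weak union. -/
lemma CondIndep.weak_union (hm : m' ≤ mΩ) (hm'' : m'' ≤ mΩ) (h₁ : m₁ ≤ mΩ) (h₂ : m₂ ≤ mΩ)
    (hle : m' ≤ m'') (hle₂ : m'' ≤ m₂) (h : CondIndep m' m₁ m₂ hm μ) :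
    CondIndep m'' m₁ m₂ hm'' μ := by
  rw [condIndep_iff_condExp_ae_eq hm h₁ h₂ (hle.trans hle₂)] at h
  rw [condIndep_iff_condExp_ae_eq hm'' h₁ h₂ hle₂]
  intro s hs
  refine (h s hs).trans ?_
  calc μ⟦s | m'⟧
    _ = μ[μ⟦s | m'⟧ | m''] := (condExp_of_stronglyMeasurable hm''
        (stronglyMeasurable_condExp.mono hle) integrable_condExp).symm
    _ =ᵐ[μ] μ[μ⟦s | m₂⟧ | m''] := condExp_congr_ae (h s hs).symm
    _ =ᵐ[μ] μ⟦s | m''⟧ := condExp_condExp_of_le hle₂ h₂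

/-- Contraction. -/
lemma CondIndep.contraction (hm : m' ≤ mΩ) (h₁ : m₁ ≤ mΩ) (h₂ : m₂ ≤ mΩ) (h₃ : m₃ ≤ mΩ)
    (hle : m' ≤ m₂) (hle₂ : m₂ ≤ m₃) (h : CondIndep m' m₁ m₂ hm μ)
    (h' : CondIndep m₂ m₁ m₃ h₂ μ) : CondIndep m' m₁ m₃ hm μ := by
  rw [condIndep_iff_condExp_ae_eq hm h₁ h₂ hle] at h
  rw [condIndep_iff_condExp_ae_eq h₂ h₁ h₃ hle₂] at h'
  rw [condIndep_iff_condExp_ae_eq hm h₁ h₃ (hle.trans hle₂)]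
  exact fun s hs => (h' s hs).trans (h s hs)

end CondIndep

/-- If `C` contains the parents of `S` outside `S`, and `A`, `C` contain
neither vertices nor descendants of `S`, then the local Markov property makes `A` independent of `C ∪ S` given `C`. -/
lemma condIndep_genBy_union_of_local_markov {V : Type*} [Finite V]
    {E : V → V → Prop} (hacyc : Acyclic E)
    {Ω : Type*} [MeasurableSpace Ω] [StandardBorelSpace Ω]
    {μ : Measure Ω} [IsFiniteMeasure μ] {X : V → Ω → ℝ} (hX : ∀ v, Measurable (X v))
    (hMarkov : ∀ v : V, CondIndep (genBy X {u | E u v}) (MeasurableSpace.comap (X v) inferInstance)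
      (genBy X {u | ¬ ReflTransGen E v u}) (genBy_le hX _) μ)
    {A C : Set V} (S : Set V)
    (hPa : ∀ b ∈ S, ∀ u, E u b → u ∈ C ∪ S)
    (hDes : ∀ b ∈ S, ∀ u ∈ A ∪ C, ¬ ReflTransGen E b u) :
    CondIndep (genBy X C) (genBy X A) (genBy X (C ∪ S)) (genBy_le hX C) μ := by
  induction S using WellFoundedLT.induction with
  | ind S ih =>
  rcases S.eq_empty_or_nonempty with rfl | hne
  · rw [Set.union_empty, condIndep_iff_condExp_ae_eq _ (genBy_le hX A) (genBy_le hX C) le_rfl]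
    exact fun _ _ => Filter.EventuallyEq.rfl
  · have hwf : WellFounded (fun a b => TransGen E b a) :=
      @Finite.wellFounded_of_trans_of_irrefl V _ _ ⟨fun _ _ _ h h' => h'.trans h⟩ ⟨hacyc⟩
    obtain ⟨v, hvS, hmax⟩ := hwf.has_min S hne
    set D := C ∪ S \ {v} with hD
    have hvv : ¬ E v v := fun h => hacyc v (.single h)
    have hCS : C ∪ S = insert v D := by
      rw [hD, ← Set.union_insert, Set.insert_sdiff_singleton, Set.insert_eq_of_mem hvS]
    have hPaD : {u | E u v} ⊆ D := by
      intro u hu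
      rcases hPa v hvS u hu with h | h
      · exact Or.inl h
      · exact Or.inr ⟨h, by rintro rfl; exact hvv hu⟩
    have hDN : D ⊆ {u | ¬ ReflTransGen E v u} := by
      rintro u (hu | ⟨hu, huv⟩)
      · exact hDes v hvS u (Or.inr hu)
      · intro h
        rcases reflTransGen_iff_eq_or_transGen.1 h with h | h
        · exact huv h
        · exact hmax u hu h
    have hAN : A ⊆ {u | ¬ ReflTransGen E v u} := fun u hu => hDes v hvS u (Or.inl hu)
    have hprev : CondIndep (genBy X C) (genBy X A) (genBy X D) (genBy_le hX C) μ := by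
      refine ih (S \ {v}) (Set.sdiff_singleton_ssubset.2 hvS) (fun b hb u hu => ?_)
        (fun b hb => hDes b hb.1)
      rcases hPa b hb.1 u hu with h | h
      · exact Or.inl h
      · exact Or.inr ⟨h, by rintro rfl; exact hmax b hb.1 (.single hu)⟩
    have hstep : CondIndep (genBy X D) (genBy X A)
        (MeasurableSpace.comap (X v) inferInstance) (genBy_le hX D) μ :=
      (condIndep_of_condIndep_of_le_right
        (CondIndep.weak_union _ (genBy_le hX D) (hX v).comap_le (genBy_le hX _)
          (genBy_mono X hPaD) (genBy_mono X hDN) (hMarkov v)) (genBy_mono X hAN)).symm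
    rw [hCS]
    refine CondIndep.contraction _ (genBy_le hX A) (genBy_le hX D) (genBy_le hX _)
      (genBy_mono X Set.subset_union_left) (genBy_mono X (Set.subset_insert v D)) hprev ?_
    rw [genBy_insert]
    exact CondIndep.sup_right _ (genBy_le hX A) (hX v).comap_le hstep

/-- if `P` satisfies the local Markov property for a finite DAG `G`
(every vertex is independent of its non-descendants given its parents), and `A, B, C` are
disjoint with `Pa(A) ⊆ C ∪ A`, `Pa(B) ⊆ C ∪ B` and `Des(B) ∩ C = ∅`, then `A ⫫ B ∣ C`. -/
theorem local_markov_implies_set_condIndep {V : Type*} [Fintype V]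
    (E : V → V → Prop) (hacyc : Acyclic E)
    {Ω : Type*} [MeasurableSpace Ω] [StandardBorelSpace Ω] [Nonempty Ω]
    (μ : Measure Ω) [IsProbabilityMeasure μ]
    (X : V → Ω → ℝ) (hX : ∀ v, Measurable (X v))
    (hMarkov : ∀ v : V,
      CondIndepFun (genBy X {u | E u v})
        ((measurable_pi_lambda _ fun u : {u | E u v} => hX u).comap_le)
        (X v) (fun ω => fun u : {u | ¬ Relation.ReflTransGen E v u} => X u ω) μ)
    (A B C : Set V)
    (hAB : Disjoint A B) (hAC : Disjoint A C) (hBC : Disjoint B C)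
    (hPaA : ∀ a ∈ A, ∀ u, E u a → u ∈ C ∪ A)
    (hPaB : ∀ b ∈ B, ∀ u, E u b → u ∈ C ∪ B)
    (hDesB : ∀ b ∈ B, ∀ u, Relation.TransGen E b u → u ∉ C) :
    CondIndepFun (genBy X C)
      ((measurable_pi_lambda _ fun c : C => hX c).comap_le)
      (fun ω => fun a : A => X a ω) (fun ω => fun b : B => X b ω) μ := by
  have hDesA : ∀ b ∈ B, ∀ u, TransGen E b u → u ∉ A := by
    intro b hb u h
    induction h with
    | single h =>
      intro ha
      rcases hPaA _ ha b h with hbC | hbA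
      · exact Set.disjoint_left.1 hBC hb hbC
      · exact Set.disjoint_left.1 hAB hbA hb
    | tail h h' ih =>
      intro ha
      rcases hPaA _ ha _ h' with hc | hc
      · exact hDesB b hb _ h hc
      · exact ih hc
  have key := condIndep_genBy_union_of_local_markov (A := A) hacyc hX
    (fun v => (condIndepFun_iff_condIndep _ _ _ _ μ).1 (hMarkov v)) B hPaB
    (fun b hb u hu h => by
      rcases reflTransGen_iff_eq_or_transGen.1 h with rfl | h
      · rcases hu with hu | hu
        · exact Set.disjoint_left.1 hAB hu hb
        · exact Set.disjoint_left.1 hBC hb hu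
      · rcases hu with hu | hu
        · exact hDesA b hb u h hu
        · exact hDesB b hb u h hu)
  exact (condIndepFun_iff_condIndep _ _ _ _ μ).2
    (condIndep_of_condIndep_of_le_right key (genBy_mono X Set.subset_union_right))
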